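/- arXiv:2209.10614 — 2 statements merged into one kernel-verified Lean document; each statement's English description precedes it below -/
import Mathlib

section
/- There exist universal constants C1, C2, C3 > 0 with the following property. Fix an integer n ≥ 1, a cost vector c ∈ ℝ^n with all entries positive, an advice vector x' ∈ [0,1]^n, a confidence parameter λ ∈ (0,1), and s ≥ 1. Then there exists a function F assigning to every finite sequence of rows a_1,…,a_i ∈ ℝ_{≥0}^n a vector F(a_1,…,a_i) ∈ [0,1]^n such that: for every m ≥ 1 and every sequence of rows a_1,…,a_m ∈ ℝ_{≥0}^n satisfying (i) for every i ≤ m and every subset T ⊆ {1,…,n} with 1 − Σ_{j∈T} a_{ij} > 0 one has Σ_{j∉T} a_{ij} ≤ s·(1 − Σ_{j∈T} a_{ij}), and (ii) there exists z ∈ [0,1]^n with ⟨a_k, z⟩ ≥ 1 for all k ≤ m, the vectors x^{(i)} := F(a_1,…,a_i) satisfy: (a) x^{(i)} ≤ x^{(i+1)} coordinatewise for every i < m; (b) ⟨a_k, x^{(i)}⟩ ≥ 1 for all k ≤ i ≤ m; (c) for every z ∈ [0,1]^n with ⟨a_k, z⟩ ≥ 1 for all k ≤ m, one has c·x^{(m)}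 ≤ C1·log(2s/λ)·(c·z) and also c·x^{(m)} ≤ (C2/(1−λ))·(c·x') + C3·log(2s)·(c·z); (d) if ⟨a_k, x'⟩ ≥ 1 for all k ≤ m, then c·x^{(m)} ≤ (C2/(1−λ))·(c·x'). -/
/-- The fractional vector `x` after raising every coordinate multiplicatively for time `t`, with
rate proportional to `a j / c j`, up to the box constraint. -/
noncomputable def grow {ι : Type*} (c a x : ι → ℝ) (δ t : ℝ) (j : ι) : ℝ :=
  min 1 ((x j + δ) * Real.exp (a j * t / c j) - δ)

/-- `y` is an admissible response to the row `a` at the current point `x`: it is monotone, stays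
in the box, satisfies the row, and its cost increase is paid for by the drop of the logarithmic
potential of every fractional solution of the row. -/
def IsStep {ι : Type*} [Fintype ι] (c : ι → ℝ) (s : ℝ) (a x y : ι → ℝ) : Prop :=
  x ≤ y ∧ y ≤ 1 ∧ 1 ≤ a ⬝ᵥ y ∧ ∀ z : ι → ℝ, 0 ≤ z → z ≤ 1 → 1 ≤ a ⬝ᵥ z →
    c ⬝ᵥ y - c ⬝ᵥ x ≤ 2 * ∑ j, z j * (c j * Real.log ((y j + s⁻¹) / (x j + s⁻¹)))

lemma exists_grow_eq_one {ι : Type*} [Fintype ι] {c a x : ι → ℝ} {δ : ℝ} (hδ : 0 < δ)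
    (hc : ∀ j, 0 < c j) (ha : 0 ≤ a) (hx : 0 ≤ x) (hx1 : x ≤ 1) (hsum : 1 ≤ ∑ j, a j)
    (hlt : a ⬝ᵥ x < 1) : ∃ t, 0 ≤ t ∧ a ⬝ᵥ grow c a x δ t = 1 := by
  set t₁ : ℝ := ∑ j, c j / (δ * a j) with ht₁
  have hterm : ∀ j, 0 ≤ c j / (δ * a j) := fun j =>
    div_nonneg (hc j).le (mul_nonneg hδ.le (ha j))
  have ht₁0 : 0 ≤ t₁ := Finset.sum_nonneg fun j _ => hterm j
  have hcont : Continuous fun t => a ⬝ᵥ grow c a x δ t := by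
    unfold dotProduct grow
    fun_prop
  have h0 : a ⬝ᵥ grow c a x δ 0 = a ⬝ᵥ x := by
    congr 1
    funext j
    simpa [grow] using hx1 j
  have h1 : 1 ≤ a ⬝ᵥ grow c a x δ t₁ := by
    refine hsum.trans (Finset.sum_le_sum fun j _ => ?_)
    rcases (ha j).eq_or_lt with h | h
    · rw [← h]; simp
    · have haj : 0 < a j := h
      have hle : c j / (δ * a j) ≤ t₁ :=
        Finset.single_le_sum (f := fun j => c j / (δ * a j)) (fun i _ => hterm i)
          (Finset.mem_univ j)
      have hu : 1 / δ ≤ a j * t₁ / c j := by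
        rw [le_div_iff₀ (hc j)]
        calc 1 / δ * c j = a j * (c j / (δ * a j)) := by field_simp
          _ ≤ a j * t₁ := by gcongr
      have hexp : 1 / δ + 1 ≤ Real.exp (a j * t₁ / c j) :=
        (add_le_add_left hu 1).trans (Real.add_one_le_exp _)
      have hmul : δ * (1 / δ + 1) ≤ (x j + δ) * Real.exp (a j * t₁ / c j) :=
        mul_le_mul (by linarith [show 0 ≤ x j from hx j]) hexp (by positivity)
          (by linarith [show 0 ≤ x j from hx j])
      have hδ1 : δ * (1 / δ + 1) = 1 + δ := by field_simp
      have hone : grow c a x δ t₁ j = 1 := min_eq_left (by linarith)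
      rw [hone, mul_one]
  obtain ⟨t, ht, hft⟩ := intermediate_value_Icc ht₁0 hcont.continuousOn
    (show (1 : ℝ) ∈ Set.Icc _ _ from ⟨by simpa only [h0] using hlt.le, h1⟩)
  exact ⟨t, ht.1, hft⟩

/-- Weak duality for one row: a point on the row whose increments `L j` are those of a
multiplicative update of length `t`, truncated at the box constraint, costs at most twice the
potential drop of any fractional solution of the row. -/
lemma cost_le_two_mul_potential {ι : Type*} [Fintype ι] [DecidableEq ι] {a y z d L : ι → ℝ}
    {s t : ℝ} (hs : 1 ≤ s) (ht : 0 ≤ t) (ha : 0 ≤ a) (hy0 : 0 ≤ y) (hy1 : y ≤ 1)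
    (hay : a ⬝ᵥ y = 1) (hz1 : z ≤ 1) (haz : 1 ≤ a ⬝ᵥ z)
    (hsp : ∀ T : Finset ι, 0 < 1 - ∑ j ∈ T, a j →
      ∑ j ∈ Tᶜ, a j ≤ s * (1 - ∑ j ∈ T, a j))
    (hL0 : 0 ≤ L) (hd : ∀ j, d j ≤ L j * (y j + s⁻¹)) (hLt : ∀ j, L j ≤ a j * t)
    (hLeq : ∀ j, y j < 1 → L j = a j * t) (hzero : ∀ j, y j = 0 → L j = 0) :
    ∑ j, d j ≤ 2 * ∑ j, z j * L j := by
  have hs0 : 0 < s := by linarith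
  have hsi : s⁻¹ ≤ 1 := inv_le_one_of_one_le₀ hs
  set T : Finset ι := Finset.univ.filter fun j => y j = 1 with hT
  have hmem : ∀ j, j ∈ T ↔ y j = 1 := fun j => by simp [hT]
  have hlt : ∀ j ∈ Tᶜ, y j < 1 := fun j hj =>
    lt_of_le_of_ne (hy1 j) fun h => Finset.mem_compl.1 hj ((hmem j).2 h)
  have hA : ∑ j ∈ T, d j ≤ ∑ j ∈ T, (2 * (z j * L j) + 2 * t * (a j - a j * z j)) := by
    refine Finset.sum_le_sum fun j hj => ?_
    have h1 := hd j
    rw [(hmem j).1 hj] at h1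
    have h2 : L j * (1 + s⁻¹) ≤ L j * 2 :=
      mul_le_mul_of_nonneg_left (by linarith) (hL0 j)
    have h3 : L j * (1 - z j) ≤ a j * t * (1 - z j) :=
      mul_le_mul_of_nonneg_right (hLt j) (sub_nonneg.2 (hz1 j))
    linarith
  have hB : ∑ j ∈ Tᶜ, d j ≤
      ∑ j ∈ Tᶜ, (2 * (z j * L j) + t * (a j * y j + s⁻¹ * a j - 2 * (a j * z j))) := by
    refine Finset.sum_le_sum fun j hj => ?_
    have h1 := hd j
    rw [hLeq j (hlt j hj)] at h1 ⊢
    linarith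
  have hTy : ∑ j ∈ T, a j * y j = ∑ j ∈ T, a j :=
    Finset.sum_congr rfl fun j hj => by rw [(hmem j).1 hj, mul_one]
  have hres : ∑ j ∈ Tᶜ, a j * y j = 1 - ∑ j ∈ T, a j := by
    rw [← hTy, ← hay, dotProduct, ← Finset.sum_add_sum_compl T]
    ring
  have hC : t * (s⁻¹ * ∑ j ∈ Tᶜ, a j) ≤ t * (1 - ∑ j ∈ T, a j) := by
    rcases lt_or_ge 0 (1 - ∑ j ∈ T, a j) with hr | hr
    · refine mul_le_mul_of_nonneg_left ?_ ht
      rw [inv_mul_le_iff₀ hs0]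
      exact hsp T hr
    · have hnn : ∀ j ∈ Tᶜ, 0 ≤ a j * y j := fun j _ => mul_nonneg (ha j) (hy0 j)
      have hr0 : ∑ j ∈ Tᶜ, a j * y j = 0 :=
        le_antisymm (hres.trans_le hr) (Finset.sum_nonneg hnn)
      have hat : ∑ j ∈ Tᶜ, a j * t = 0 := by
        refine Finset.sum_eq_zero fun j hj => ?_
        rcases mul_eq_zero.1 ((Finset.sum_eq_zero_iff_of_nonneg hnn).1 hr0 j hj) with h | h
        · rw [h, zero_mul]
        · rw [← hLeq j (hlt j hj), hzero j h]
      rw [← Finset.sum_mul] at hat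
      rw [← hres, hr0]
      nlinarith
  have hz : 1 ≤ ∑ j ∈ T, a j * z j + ∑ j ∈ Tᶜ, a j * z j := by
    rwa [Finset.sum_add_sum_compl]
  simp only [Finset.sum_add_distrib, Finset.sum_sub_distrib, ← Finset.mul_sum] at hA hB
  rw [hres] at hB
  rw [← Finset.sum_add_sum_compl T, ← Finset.sum_add_sum_compl T fun j => z j * L j]
  nlinarith [mul_le_mul_of_nonneg_left hz ht]

lemma exists_isStep {ι : Type*} [Fintype ι] [DecidableEq ι] {c a x : ι → ℝ} {s : ℝ}
    (hs : 1 ≤ s) (hc : ∀ j, 0 < c j) (ha : 0 ≤ a) (hx : 0 ≤ x) (hx1 : x ≤ 1)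
    (hsum : 1 ≤ ∑ j, a j)
    (hsp : ∀ T : Finset ι, 0 < 1 - ∑ j ∈ T, a j →
      ∑ j ∈ Tᶜ, a j ≤ s * (1 - ∑ j ∈ T, a j)) :
    ∃ y, IsStep c s a x y := by
  have hδ : 0 < s⁻¹ := inv_pos.2 (by linarith)
  have hxδ : ∀ j, 0 < x j + s⁻¹ := fun j => add_pos_of_nonneg_of_pos (hx j) hδ
  rcases le_or_gt 1 (a ⬝ᵥ x) with hax | hax
  · refine ⟨x, le_rfl, hx1, hax, fun z _ _ _ => ?_⟩
    simp [div_self (hxδ _).ne']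
  obtain ⟨t, ht, hat⟩ := exists_grow_eq_one (c := c) hδ hc ha hx hx1 hsum hax
  set y := grow c a x s⁻¹ t with hy
  have hu : ∀ j, 0 ≤ a j * t / c j := fun j =>
    div_nonneg (mul_nonneg (ha j) ht) (hc j).le
  have hy1 : y ≤ 1 := fun j => min_le_left _ _
  have hxy : x ≤ y := fun j => le_min (hx1 j) (by
    nlinarith [Real.one_le_exp (hu j), hxδ j])
  have hyδ : ∀ j, 0 < y j + s⁻¹ := fun j => (hxδ j).trans_le (add_le_add_left (hxy j) _)
  have hq : ∀ j, 0 < (y j + s⁻¹) / (x j + s⁻¹) := fun j => div_pos (hyδ j) (hxδ j)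
  refine ⟨y, hxy, hy1, hat.ge, fun z _ hz1 haz => ?_⟩
  rw [← dotProduct_sub]
  refine cost_le_two_mul_potential hs ht ha (hx.trans hxy) hy1 hat hz1 haz hsp ?_ ?_ ?_ ?_ ?_
  · refine fun j => mul_nonneg (hc j).le (Real.log_nonneg ?_)
    rw [le_div_iff₀ (hxδ j), one_mul]
    exact add_le_add_left (hxy j) _
  · intro j
    have h := mul_le_mul_of_nonneg_right (Real.one_sub_inv_le_log_of_pos (hq j)) (hyδ j).le
    have h' : (1 - ((y j + s⁻¹) / (x j + s⁻¹))⁻¹) * (y j + s⁻¹) = y j - x j := by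
      rw [inv_div, sub_mul, div_mul_cancel₀ _ (hyδ j).ne']
      ring
    rw [h'] at h
    rw [mul_assoc]
    exact mul_le_mul_of_nonneg_left h (hc j).le
  · intro j
    rw [← le_div_iff₀' (hc j), Real.log_le_iff_le_exp (hq j), div_le_iff₀' (hxδ j)]
    exact le_sub_iff_add_le.1 (min_le_right _ _)
  · intro j hj
    have hyj : y j = (x j + s⁻¹) * Real.exp (a j * t / c j) - s⁻¹ :=
      min_eq_right (not_lt.1 fun h => hj.ne (min_eq_left h.le))
    rw [hyj, sub_add_cancel, mul_div_cancel_left₀ _ (hxδ j).ne', Real.log_exp,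
      mul_div_cancel₀ _ (hc j).ne']
  · intro j hj
    have hxj : x j = y j := le_antisymm (hxy j) (hj.le.trans (hx j))
    rw [hxj, div_self (hyδ j).ne', Real.log_one, mul_zero]

open Classical in
/-- One step of the advice-free online algorithm. -/
noncomputable def coverStep {ι : Type*} [Fintype ι] (c : ι → ℝ) (s : ℝ) (a x : ι → ℝ) : ι → ℝ :=
  if h : ∃ y, IsStep c s a x y then h.choose else x

/-- The advice-free online algorithm after the first `i` rows of `a`. -/
noncomputable def onlineCover {ι : Type*} [Fintype ι] (c : ι → ℝ) (s : ℝ) (a : ℕ → ι → ℝ) :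
    ℕ → ι → ℝ
  | 0 => 0
  | i + 1 => coverStep c s (a i) (onlineCover c s a i)

open Classical in
/-- The last state among the first `i` ones of the advice-free algorithm whose cost is at most
that of the advice. -/
noncomputable def cappedCover {ι : Type*} [Fintype ι] (c x' : ι → ℝ) (s : ℝ) (a : ℕ → ι → ℝ) :
    ℕ → ι → ℝ
  | 0 => 0
  | i + 1 => if c ⬝ᵥ onlineCover c s a (i + 1) ≤ c ⬝ᵥ x' then onlineCover c s a (i + 1)
      else cappedCover c x' s a i

open Classical in
/-- The learning-augmented algorithm: run the advice-free algorithm until it becomes more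
expensive than the advice, then add the advice to the last cheap state for as long as the advice
is feasible, and finally to the current state of the advice-free algorithm. -/
noncomputable def advisedCover {ι : Type*} [Fintype ι] (c x' : ι → ℝ) (s : ℝ) (a : ℕ → ι → ℝ)
    (i : ℕ) : ι → ℝ :=
  if c ⬝ᵥ onlineCover c s a i ≤ c ⬝ᵥ x' then onlineCover c s a i
  else if ∀ k < i, 1 ≤ a k ⬝ᵥ x' then cappedCover c x' s a i ⊔ x'
  else onlineCover c s a i ⊔ x'

lemma sup_le_add_of_nonneg {ι : Type*} {x y : ι → ℝ} (hx : 0 ≤ x) (hy : 0 ≤ y) : x ⊔ y ≤ x + y :=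
  sup_le (le_add_of_nonneg_right hy) (le_add_of_nonneg_left hx)

section Online

variable {ι : Type*} [Fintype ι] {c x' : ι → ℝ} {s : ℝ} {a b : ℕ → ι → ℝ}

lemma le_coverStep (c : ι → ℝ) (s : ℝ) (r x : ι → ℝ) : x ≤ coverStep c s r x := by
  unfold coverStep
  split_ifs with h
  exacts [h.choose_spec.1, le_rfl]

lemma coverStep_le_one (c : ι → ℝ) (s : ℝ) (r : ι → ℝ) {x : ι → ℝ} (hx : x ≤ 1) :
    coverStep c s r x ≤ 1 := by
  unfold coverStep
  split_ifs with h
  exacts [h.choose_spec.2.1, hx]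

lemma isStep_coverStep {r x : ι → ℝ} (h : ∃ y, IsStep c s r x y) :
    IsStep c s r x (coverStep c s r x) := by
  rw [coverStep, dif_pos h]
  exact h.choose_spec

lemma onlineCover_monotone (c : ι → ℝ) (s : ℝ) (a : ℕ → ι → ℝ) : Monotone (onlineCover c s a) :=
  monotone_nat_of_le_succ fun _ => le_coverStep _ _ _ _

lemma onlineCover_nonneg (c : ι → ℝ) (s : ℝ) (a : ℕ → ι → ℝ) (i : ℕ) : 0 ≤ onlineCover c s a i :=
  onlineCover_monotone c s a i.zero_le

lemma onlineCover_le_one (c : ι → ℝ) (s : ℝ) (a : ℕ → ι → ℝ) (i : ℕ) :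
    onlineCover c s a i ≤ 1 := by
  induction i with
  | zero => exact zero_le_one
  | succ i ih => exact coverStep_le_one _ _ _ ih

lemma onlineCover_congr {i : ℕ} (h : ∀ k < i, a k = b k) :
    onlineCover c s a i = onlineCover c s b i := by
  induction i with
  | zero => rfl
  | succ i ih =>
    simp only [onlineCover]
    rw [ih fun k hk => h k (hk.trans i.lt_succ_self), h i i.lt_succ_self]

lemma cappedCover_congr {i : ℕ} (h : ∀ k < i, a k = b k) :
    cappedCover c x' s a i = cappedCover c x' s b i := by
  induction i with
  | zero => rfl
  | succ i ih =>
    simp only [cappedCover]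
    rw [ih fun k hk => h k (hk.trans i.lt_succ_self), onlineCover_congr h]

lemma advisedCover_congr {i : ℕ} (h : ∀ k < i, a k = b k) :
    advisedCover c x' s a i = advisedCover c x' s b i := by
  have hfeas : (∀ k < i, 1 ≤ a k ⬝ᵥ x') ↔ ∀ k < i, 1 ≤ b k ⬝ᵥ x' :=
    forall₂_congr fun k hk => by rw [h k hk]
  simp only [advisedCover, hfeas, onlineCover_congr h, cappedCover_congr h]

lemma cappedCover_le_onlineCover (c x' : ι → ℝ) (s : ℝ) (a : ℕ → ι → ℝ) (i : ℕ) :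
    cappedCover c x' s a i ≤ onlineCover c s a i := by
  induction i with
  | zero => exact le_rfl
  | succ i ih =>
    unfold cappedCover
    split_ifs
    exacts [le_rfl, ih.trans (onlineCover_monotone c s a i.le_succ)]

lemma cappedCover_nonneg (c x' : ι → ℝ) (s : ℝ) (a : ℕ → ι → ℝ) (i : ℕ) :
    0 ≤ cappedCover c x' s a i := by
  induction i with
  | zero => exact le_rfl
  | succ i ih =>
    unfold cappedCover
    split_ifs
    exacts [onlineCover_nonneg _ _ _ _, ih]

lemma cappedCover_monotone (c x' : ι → ℝ) (s : ℝ) (a : ℕ → ι → ℝ) :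
    Monotone (cappedCover c x' s a) := by
  refine monotone_nat_of_le_succ fun i => ?_
  rw [cappedCover]
  split_ifs
  exacts [(cappedCover_le_onlineCover c x' s a i).trans (onlineCover_monotone c s a i.le_succ),
    le_rfl]

lemma dotProduct_cappedCover_le (hc : 0 ≤ c) (hx' : 0 ≤ x') (i : ℕ) :
    c ⬝ᵥ cappedCover c x' s a i ≤ c ⬝ᵥ x' := by
  induction i with
  | zero => simpa [cappedCover] using dotProduct_nonneg_of_nonneg hc hx'
  | succ i ih =>
    unfold cappedCover
    split_ifs with h
    exacts [h, ih]

lemma cappedCover_eq_onlineCover {i : ℕ} (h : c ⬝ᵥ onlineCover c s a i ≤ c ⬝ᵥ x') :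
    cappedCover c x' s a i = onlineCover c s a i := by
  cases i with
  | zero => rfl
  | succ i => rw [cappedCover, if_pos h]

lemma advisedCover_nonneg (hx' : 0 ≤ x') (i : ℕ) : 0 ≤ advisedCover c x' s a i := by
  unfold advisedCover
  split_ifs
  exacts [onlineCover_nonneg _ _ _ _, le_sup_of_le_right hx', le_sup_of_le_right hx']

lemma advisedCover_le_one (hx1 : x' ≤ 1) (i : ℕ) : advisedCover c x' s a i ≤ 1 := by
  have h := onlineCover_le_one c s a i
  unfold advisedCover
  split_ifs
  exacts [h, sup_le ((cappedCover_le_onlineCover _ _ _ _ _).trans h) hx1, sup_le h hx1]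

lemma advisedCover_monotone (hc : 0 ≤ c) : Monotone (advisedCover c x' s a) := by
  refine monotone_nat_of_le_succ fun i => ?_
  have hmono := onlineCover_monotone c s a i.le_succ
  have hcap := cappedCover_monotone c x' s a i.le_succ
  have hle := cappedCover_le_onlineCover c x' s a i
  have hcost := dotProduct_le_dotProduct_of_nonneg_left hmono hc
  unfold advisedCover
  by_cases h₁ : c ⬝ᵥ onlineCover c s a (i + 1) ≤ c ⬝ᵥ x'
  · rw [if_pos h₁, if_pos (hcost.trans h₁)]
    exact hmono
  rw [if_neg h₁]
  by_cases h₂ : ∀ k < i + 1, 1 ≤ a k ⬝ᵥ x'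
  · rw [if_pos h₂, if_pos fun k hk => h₂ k (hk.trans i.lt_succ_self)]
    split_ifs with h₀
    · rw [← cappedCover_eq_onlineCover h₀]
      exact hcap.trans le_sup_left
    · exact sup_le_sup_right hcap _
  · rw [if_neg h₂]
    split_ifs
    exacts [hmono.trans le_sup_left, sup_le_sup_right (hle.trans hmono) _,
      sup_le_sup_right hmono _]

lemma one_le_dotProduct_advisedCover {i k : ℕ} (hk : k < i) (ha : 0 ≤ a k)
    (h : 1 ≤ a k ⬝ᵥ onlineCover c s a i) : 1 ≤ a k ⬝ᵥ advisedCover c x' s a i := by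
  unfold advisedCover
  split_ifs with h₁ h₂
  · exact h
  · exact (h₂ k hk).trans (dotProduct_le_dotProduct_of_nonneg_left le_sup_right ha)
  · exact h.trans (dotProduct_le_dotProduct_of_nonneg_left le_sup_left ha)

lemma dotProduct_advisedCover_le_online (hc : 0 ≤ c) (hx' : 0 ≤ x') (i : ℕ) :
    c ⬝ᵥ advisedCover c x' s a i ≤ 2 * c ⬝ᵥ onlineCover c s a i := by
  have h0 := onlineCover_nonneg c s a i
  have hle := dotProduct_le_dotProduct_of_nonneg_left (cappedCover_le_onlineCover c x' s a i) hc
  have hsup : ∀ x : ι → ℝ, 0 ≤ x → c ⬝ᵥ (x ⊔ x') ≤ c ⬝ᵥ x + c ⬝ᵥ x' := fun x hx => by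
    rw [← dotProduct_add]
    exact dotProduct_le_dotProduct_of_nonneg_left (sup_le_add_of_nonneg hx hx') hc
  unfold advisedCover
  split_ifs with h₁ h₂
  · linarith [dotProduct_nonneg_of_nonneg hc h0]
  · linarith [hsup _ (cappedCover_nonneg c x' s a i)]
  · linarith [hsup _ h0]

lemma dotProduct_advisedCover_le_advice (hc : 0 ≤ c) (hx' : 0 ≤ x') {i : ℕ}
    (h : ∀ k < i, 1 ≤ a k ⬝ᵥ x') : c ⬝ᵥ advisedCover c x' s a i ≤ 2 * c ⬝ᵥ x' := by
  unfold advisedCover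
  split_ifs with h₁
  · linarith [dotProduct_nonneg_of_nonneg hc hx']
  · have := dotProduct_le_dotProduct_of_nonneg_left
      (sup_le_add_of_nonneg (cappedCover_nonneg c x' s a i) hx') hc
    rw [dotProduct_add] at this
    linarith [dotProduct_cappedCover_le (s := s) (a := a) hc hx' i]

lemma one_le_dotProduct_onlineCover {m i k : ℕ} (ha : ∀ k < m, 0 ≤ a k)
    (hstep : ∀ k < m, IsStep c s (a k) (onlineCover c s a k) (onlineCover c s a (k + 1)))
    (hi : i ≤ m) (hk : k < i) : 1 ≤ a k ⬝ᵥ onlineCover c s a i :=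
  (hstep k (hk.trans_le hi)).2.2.1.trans
    (dotProduct_le_dotProduct_of_nonneg_left (onlineCover_monotone c s a hk) (ha k (hk.trans_le hi)))

lemma dotProduct_onlineCover_le_potential {m : ℕ} (hs : 0 < s)
    (hstep : ∀ k < m, IsStep c s (a k) (onlineCover c s a k) (onlineCover c s a (k + 1)))
    {z : ι → ℝ} (hz : 0 ≤ z) (hz1 : z ≤ 1) (haz : ∀ k < m, 1 ≤ a k ⬝ᵥ z) :
    c ⬝ᵥ onlineCover c s a m ≤
      2 * ∑ j, z j * (c j * Real.log ((onlineCover c s a m j + s⁻¹) / s⁻¹)) := by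
  have hδ : 0 < s⁻¹ := inv_pos.2 hs
  induction m with
  | zero => simp [onlineCover, div_self hδ.ne']
  | succ m ih =>
    have h := ih (fun k hk => hstep k (hk.trans m.lt_succ_self))
      fun k hk => haz k (hk.trans m.lt_succ_self)
    have hlast := (hstep m m.lt_succ_self).2.2.2 z hz hz1 (haz m m.lt_succ_self)
    have hpos : ∀ i j, 0 < onlineCover c s a i j + s⁻¹ := fun i j =>
      add_pos_of_nonneg_of_pos (onlineCover_nonneg c s a i j) hδ
    have hsum : ∑ j, z j * (c j * Real.log ((onlineCover c s a (m + 1) j + s⁻¹) / s⁻¹)) =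
        ∑ j, z j * (c j * Real.log ((onlineCover c s a m j + s⁻¹) / s⁻¹)) +
        ∑ j, z j * (c j * Real.log ((onlineCover c s a (m + 1) j + s⁻¹) /
          (onlineCover c s a m j + s⁻¹))) := by
      rw [← Finset.sum_add_distrib]
      refine Finset.sum_congr rfl fun j _ => ?_
      rw [Real.log_div (hpos _ j).ne' hδ.ne', Real.log_div (hpos _ j).ne' hδ.ne',
        Real.log_div (hpos _ j).ne' (hpos _ j).ne']
      ring
    rw [hsum]
    linarith

lemma dotProduct_onlineCover_le {m : ℕ} (hs : 1 ≤ s) (hc : 0 ≤ c)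
    (hstep : ∀ k < m, IsStep c s (a k) (onlineCover c s a k) (onlineCover c s a (k + 1)))
    {z : ι → ℝ} (hz : 0 ≤ z) (hz1 : z ≤ 1) (haz : ∀ k < m, 1 ≤ a k ⬝ᵥ z) :
    c ⬝ᵥ onlineCover c s a m ≤ 2 * Real.log (2 * s) * c ⬝ᵥ z := by
  have hs0 : 0 < s := by linarith
  refine (dotProduct_onlineCover_le_potential hs0 hstep hz hz1 haz).trans ?_
  rw [mul_assoc, dotProduct, Finset.mul_sum (f := fun j => c j * z j)]
  refine mul_le_mul_of_nonneg_left (Finset.sum_le_sum fun j _ => ?_) zero_le_two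
  have h0 : 0 ≤ onlineCover c s a m j := onlineCover_nonneg c s a m j
  have h1 : onlineCover c s a m j ≤ 1 := onlineCover_le_one c s a m j
  have hlog : Real.log ((onlineCover c s a m j + s⁻¹) / s⁻¹) ≤ Real.log (2 * s) := by
    refine Real.log_le_log (by positivity) ?_
    rw [div_inv_eq_mul, add_mul, inv_mul_cancel₀ hs0.ne']
    nlinarith
  calc z j * (c j * Real.log ((onlineCover c s a m j + s⁻¹) / s⁻¹))
      ≤ z j * (c j * Real.log (2 * s)) :=
        mul_le_mul_of_nonneg_left (mul_le_mul_of_nonneg_left hlog (hc j)) (hz j)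
    _ = Real.log (2 * s) * (c j * z j) := by ring

lemma isStep_onlineCover [DecidableEq ι] {k : ℕ} (hs : 1 ≤ s) (hc : ∀ j, 0 < c j) (ha : 0 ≤ a k)
    (hsum : 1 ≤ ∑ j, a k j)
    (hsp : ∀ T : Finset ι, 0 < 1 - ∑ j ∈ T, a k j →
      ∑ j ∈ Tᶜ, a k j ≤ s * (1 - ∑ j ∈ T, a k j)) :
    IsStep c s (a k) (onlineCover c s a k) (onlineCover c s a (k + 1)) :=
  isStep_coverStep (exists_isStep hs hc ha (onlineCover_nonneg c s a k)
    (onlineCover_le_one c s a k) hsum hsp)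

end Online

/-- Learning-augmented online covering LP with box constraints (Theorem 1.3 /
Theorem 2.2): there is an online algorithm `F` (mapping each prefix of rows to a
solution in `[0,1]^n`) that is monotone, feasible, `O(log(s/λ))`-robust and
`O(1/(1−λ))`-consistent, where `s` is the sparsity parameter of the instance. -/
theorem stmt1 :
    ∃ C1 C2 C3 : ℝ, 0 < C1 ∧ 0 < C2 ∧ 0 < C3 ∧
      ∀ (n : ℕ), 1 ≤ n →
      ∀ (c x' : Fin n → ℝ), (∀ j, 0 < c j) → (∀ j, 0 ≤ x' j ∧ x' j ≤ 1) →
      ∀ (lam : ℝ), 0 < lam → lam < 1 →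
      ∀ (s : ℝ), 1 ≤ s →
      ∃ F : (i : ℕ) → (Fin i → (Fin n → ℝ)) → (Fin n → ℝ),
        -- F always outputs a vector in [0,1]^n on sequences of nonnegative rows
        (∀ (i : ℕ) (as : Fin i → (Fin n → ℝ)),
          (∀ k j, 0 ≤ as k j) → ∀ j, 0 ≤ F i as j ∧ F i as j ≤ 1) ∧
        ∀ (m : ℕ), 1 ≤ m → ∀ (a : ℕ → (Fin n → ℝ)),
          (∀ k, k < m → ∀ j, 0 ≤ a k j) →
          -- (i) sparsity condition
          (∀ k, k < m → ∀ T : Finset (Fin n),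
            0 < 1 - ∑ j ∈ T, a k j →
            ∑ j ∈ Tᶜ, a k j ≤ s * (1 - ∑ j ∈ T, a k j)) →
          -- (ii) existence of a feasible solution in [0,1]^n
          (∃ z : Fin n → ℝ, (∀ j, 0 ≤ z j ∧ z j ≤ 1) ∧
            ∀ k, k < m → 1 ≤ ∑ j, a k j * z j) →
          -- (a) monotonicity
          ((∀ i, i < m → ∀ j,
              F i (fun k : Fin i => a k.1) j ≤ F (i + 1) (fun k : Fin (i + 1) => a k.1) j) ∧
          -- (b) feasibility
          (∀ i, i ≤ m → ∀ k, k < i →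
              1 ≤ ∑ j, a k j * F i (fun k' : Fin i => a k'.1) j) ∧
          -- (c) robustness and consistency against any feasible z ∈ [0,1]^n
          (∀ z : Fin n → ℝ, (∀ j, 0 ≤ z j ∧ z j ≤ 1) →
            (∀ k, k < m → 1 ≤ ∑ j, a k j * z j) →
            (∑ j, c j * F m (fun k : Fin m => a k.1) j ≤
              C1 * Real.log (2 * s / lam) * ∑ j, c j * z j) ∧
            (∑ j, c j * F m (fun k : Fin m => a k.1) j ≤
              C2 / (1 - lam) * ∑ j, c j * x' j +
                C3 * Real.log (2 * s) * ∑ j, c j * z j)) ∧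
          -- (d) consistency when the advice is feasible
          ((∀ k, k < m → 1 ≤ ∑ j, a k j * x' j) →
            ∑ j, c j * F m (fun k : Fin m => a k.1) j ≤
              C2 / (1 - lam) * ∑ j, c j * x' j)) := by
  refine ⟨4, 2, 4, by norm_num, by norm_num, by norm_num, ?_⟩
  intro n _ c x' hc hx' lam hlam hlam1 s hs
  have hc0 : 0 ≤ c := fun j => (hc j).le
  have hx0 : 0 ≤ x' := fun j => (hx' j).1
  have hx1 : x' ≤ 1 := fun j => (hx' j).2
  have hadv : 2 * (c ⬝ᵥ x') ≤ 2 / (1 - lam) * (c ⬝ᵥ x') := by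
    refine mul_le_mul_of_nonneg_right ?_ (dotProduct_nonneg_of_nonneg hc0 hx0)
    rw [le_div_iff₀ (by linarith)]
    linarith
  refine ⟨fun i as => advisedCover c x' s (fun k => if h : k < i then as ⟨k, h⟩ else 0) i,
    fun i as _ j => ⟨advisedCover_nonneg hx0 i j, advisedCover_le_one hx1 i j⟩, ?_⟩
  rintro m - a ha hsp ⟨z₀, hz₀, haz₀⟩
  have hF : ∀ i, advisedCover c x' s (fun k => if k < i then a k else 0) i =
      advisedCover c x' s a i := fun i => advisedCover_congr fun k hk => if_pos hk
  have hstep : ∀ k < m,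
      IsStep c s (a k) (onlineCover c s a k) (onlineCover c s a (k + 1)) := fun k hk =>
    isStep_onlineCover hs hc (ha k hk)
      ((haz₀ k hk).trans (Finset.sum_le_sum fun j _ =>
        mul_le_of_le_one_right (ha k hk j) (hz₀ j).2)) (hsp k hk)
  simp only [dite_eq_ite, hF]
  refine ⟨fun i _ => advisedCover_monotone hc0 i.le_succ, fun i hi k hk =>
    one_le_dotProduct_advisedCover hk (ha k (hk.trans_le hi))
      (one_le_dotProduct_onlineCover ha hstep hi hk), fun z hz haz => ?_, fun h =>
    (dotProduct_advisedCover_le_advice hc0 hx0 h).trans hadv⟩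
  have hz0 : 0 ≤ z := fun j => (hz j).1
  have hcz : 0 ≤ c ⬝ᵥ z := dotProduct_nonneg_of_nonneg hc0 hz0
  have hmain : c ⬝ᵥ advisedCover c x' s a m ≤ 4 * Real.log (2 * s) * (c ⬝ᵥ z) := by
    linarith [dotProduct_advisedCover_le_online (s := s) (a := a) hc0 hx0 m,
      dotProduct_onlineCover_le hs hc0 hstep hz0 (fun j => (hz j).2) haz]
  have hlog : Real.log (2 * s) ≤ Real.log (2 * s / lam) :=
    Real.log_le_log (by linarith) (le_div_self (by linarith) hlam hlam1.le)
  refine ⟨hmain.trans (mul_le_mul_of_nonneg_right (by linarith) hcz), hmain.trans ?_⟩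
  exact le_add_of_nonneg_left (mul_nonneg (div_nonneg zero_le_two (by linarith))
    (dotProduct_nonneg_of_nonneg hc0 hx0))
end

section
/- There exist universal constants C1, C2, C3 > 0 with the following property. Fix integers n, d ≥ 1, real symmetric positive semidefinite d×d matrices A_1,…,A_n, a cost vector c ∈ ℝ^n with all entries positive, an advice vector x' ∈ ℝ_{≥0}^n, a confidence parameter λ ∈ (0,1), and κ ≥ 1. Then there exists a function F assigning to every finite sequence of d×d real symmetric positive semidefinite matrices B^{(1)},…,B^{(i)} a vector F(B^{(1)},…,B^{(i)}) ∈ ℝ_{≥0}^n such that: for every m ≥ 1 and every sequence B^{(1)},…,B^{(m)} of d×d real symmetric positive semidefinite matrices with B^{(i)} − B^{(i−1)} positive semidefinite for all 1 < i ≤ m, satisfying (i) every two positive eigenvalues μ, ν of any (possibly different) matrices among A_1,…,A_n, B^{(1)},…,B^{(m)} obey μ ≤ κ·ν, and (ii) there exists z ∈ ℝ_{≥0}^n with Σ_j z_j A_j − B^{(m)} positive semidefinite, the vectors x^{(i)} := F(B^{(1)},…,B^{(i)}) satisfy: (a) x^{(i)} ≤ x^{(i+1)} coordinatewise for every i < m;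 (b) Σ_j x^{(i)}_j A_j − B^{(i)} is positive semidefinite for every i ≤ m; (c) for every z ∈ ℝ_{≥0}^n with Σ_j z_j A_j − B^{(m)} positive semidefinite, one has c·x^{(m)} ≤ C1·log(2κn/λ)·(c·z) and also c·x^{(m)} ≤ (C2/(1−λ))·(c·x') + C3·log(2κn)·(c·z); (d) if Σ_j x'_j A_j − B^{(m)} is positive semidefinite, then c·x^{(m)} ≤ (C2/(1−λ))·(c·x'). -/
open Matrix

/-- The closed, convex, upward closed subsets of the nonnegative orthant. -/
structure IsCoveringSet {ι : Type*} (K : Set (ι → ℝ)) : Prop where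
  nonneg : ∀ x ∈ K, 0 ≤ x
  closed : IsClosed K
  convex : Convex ℝ K
  upward : ∀ x ∈ K, ∀ y, x ≤ y → y ∈ K

section Projection

variable {ι : Type*} [Fintype ι] {K : Set (ι → ℝ)} {c ε x y z : ι → ℝ}

theorem IsCoveringSet.exists_forall_le (hK : IsCoveringSet K) (hne : K.Nonempty)
    (hc : ∀ j, 0 < c j) {f : (ι → ℝ) → ℝ} (hf : ContinuousOn f K) {b : ℝ}
    (hb : ∀ y ∈ K, c ⬝ᵥ y ≤ f y + b) : ∃ y ∈ K, ∀ z ∈ K, f y ≤ f z := by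
  obtain ⟨z₀, hz₀⟩ := hne
  have hcont : Continuous fun y : ι → ℝ => c ⬝ᵥ y := by
    unfold dotProduct; fun_prop
  have hT : IsCompact (K ∩ {y | c ⬝ᵥ y ≤ f z₀ + b}) := by
    refine (isCompact_Icc (a := (0 : ι → ℝ)) (b := fun j => (f z₀ + b) / c j)).of_isClosed_subset
      (hK.closed.inter (isClosed_le hcont continuous_const)) ?_
    rintro y ⟨hy, hyb⟩
    refine ⟨hK.nonneg y hy, fun j => ?_⟩
    rw [le_div_iff₀ (hc j), mul_comm]
    refine le_trans ?_ hyb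
    exact Finset.single_le_sum (f := fun j => c j * y j)
      (fun i _ => mul_nonneg (hc i).le (hK.nonneg y hy i)) (Finset.mem_univ j)
  obtain ⟨y, hy, hmin⟩ := hT.exists_isMinOn ⟨z₀, hz₀, hb z₀ hz₀⟩ (hf.mono Set.inter_subset_left)
  refine ⟨y, hy.1, fun z hz => ?_⟩
  by_cases hzb : c ⬝ᵥ z ≤ f z₀ + b
  · exact hmin ⟨hz, hzb⟩
  · have h1 : f y ≤ f z₀ := hmin ⟨hz₀, hb z₀ hz₀⟩
    have h2 := hb z hz
    linarith

/-- First-order optimality condition for the entropic Bregman projection of `x` onto `K`. -/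
theorem IsCoveringSet.exists_entropic_projection (hK : IsCoveringSet K) (hne : K.Nonempty)
    (hc : ∀ j, 0 < c j) (hε : ∀ j, 0 < ε j) (hx : 0 ≤ x) :
    ∃ y ∈ K, ∀ z ∈ K,
      0 ≤ ∑ j, c j * ((Real.log (y j + ε j) - Real.log (x j + ε j)) * (z j - y j)) := by
  let f : (ι → ℝ) → ℝ := fun y => ∑ j, c j *
    ((y j + ε j) * Real.log (y j + ε j) - (y j + ε j) * (Real.log (x j + ε j) + 1))
  have hf : Continuous f := by
    refine continuous_finsetSum _ fun j _ => continuous_const.mul (Continuous.sub ?_ (by fun_prop))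
    exact Real.continuous_mul_log.comp (by fun_prop)
  obtain ⟨y, hy, hmin⟩ := hK.exists_forall_le hne hc hf.continuousOn
    (b := ∑ j, c j * (Real.exp 1 * (x j + ε j))) (by
      intro y hy
      simp only [f, dotProduct, ← Finset.sum_add_distrib]
      refine Finset.sum_le_sum fun j _ => ?_
      rw [← mul_add]
      refine mul_le_mul_of_nonneg_left ?_ (hc j).le
      have ha : 0 < y j + ε j := add_pos_of_nonneg_of_pos (hK.nonneg y hy j) (hε j)
      have hb : 0 < x j + ε j := add_pos_of_nonneg_of_pos (hx j) (hε j)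
      have hlog := Real.one_sub_inv_le_log_of_pos
        (div_pos ha (mul_pos (Real.exp_pos 1) hb))
      rw [Real.log_div ha.ne' (by positivity), Real.log_mul (by positivity) hb.ne',
        Real.log_exp, inv_div] at hlog
      have hmul := mul_le_mul_of_nonneg_left hlog ha.le
      rw [mul_sub, mul_div_cancel₀ _ ha.ne'] at hmul
      have := hε j
      nlinarith)
  refine ⟨y, hy, fun z hz => ?_⟩
  let g : ℝ → ℝ := fun t => f (y + t • (z - y))
  have hderiv : HasDerivAt g
      (∑ j, c j * ((Real.log (y j + ε j) - Real.log (x j + ε j)) * (z j - y j))) 0 := by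
    simp only [g, f, Pi.add_apply, Pi.smul_apply, Pi.sub_apply, smul_eq_mul]
    refine HasDerivAt.fun_sum fun j _ => HasDerivAt.const_mul _ ?_
    have ha : y j + ε j ≠ 0 := (add_pos_of_nonneg_of_pos (hK.nonneg y hy j) (hε j)).ne'
    have hlin : HasDerivAt (fun t : ℝ => y j + t * (z j - y j) + ε j) (z j - y j) 0 := by
      simpa using (((hasDerivAt_id (0 : ℝ)).mul_const (z j - y j)).const_add (y j)).add_const (ε j)
    have hlog := HasDerivAt.comp (h₂ := fun a => a * Real.log a) (0 : ℝ)
      (by simpa using Real.hasDerivAt_mul_log ha) hlin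
    refine (hlog.sub (hlin.mul_const (Real.log (x j + ε j) + 1))).congr_deriv ?_
    ring
  have hslope := (hasDerivWithinAt_iff_tendsto_slope' (s := Set.Ioi (0 : ℝ))
    Set.self_notMem_Ioi).1 hderiv.hasDerivWithinAt
  refine ge_of_tendsto hslope ?_
  filter_upwards [Ioo_mem_nhdsGT (zero_lt_one' ℝ)] with t ht
  rw [slope_def_field]
  refine div_nonneg (sub_nonneg.2 ?_) (by linarith [ht.1])
  have := hmin _ (hK.convex.add_smul_sub_mem hy hz ⟨ht.1.le, ht.2.le⟩)
  simpa [g] using this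

theorem IsCoveringSet.le_entropic_projection (hK : IsCoveringSet K)
    (hc : ∀ j, 0 < c j) (hε : ∀ j, 0 < ε j) (hy : y ∈ K)
    (hproj : ∀ z ∈ K,
      0 ≤ ∑ j, c j * ((Real.log (y j + ε j) - Real.log (x j + ε j)) * (z j - y j))) :
    x ≤ y := by
  have hterm : ∀ j, c j * ((Real.log (y j + ε j) - Real.log (x j + ε j)) *
      ((y ⊔ x) j - y j)) ≤ 0 := by
    intro j
    refine mul_nonpos_of_nonneg_of_nonpos (hc j).le ?_
    rcases le_total (x j) (y j) with h | h
    · simp [h]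
    · refine mul_nonpos_of_nonpos_of_nonneg (sub_nonpos.2 (Real.log_le_log
        (add_pos_of_nonneg_of_pos (hK.nonneg y hy j) (hε j)) (by linarith))) ?_
      simp
  intro j
  by_contra! hlt
  have hneg : c j * ((Real.log (y j + ε j) - Real.log (x j + ε j)) *
      ((y ⊔ x) j - y j)) < 0 := by
    refine mul_neg_of_pos_of_neg (hc j) (mul_neg_of_neg_of_pos (sub_neg.2 (Real.log_lt_log
        (add_pos_of_nonneg_of_pos (hK.nonneg y hy j) (hε j)) (by linarith))) ?_)
    simpa using hlt
  have hlt' := Finset.sum_lt_sum (fun i _ => hterm i) ⟨j, Finset.mem_univ j, hneg⟩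
  have := hproj _ (hK.upward y hy (y ⊔ x) le_sup_left)
  simp only [Finset.sum_const_zero] at hlt'
  linarith

theorem IsCoveringSet.cost_entropic_projection (hK : IsCoveringSet K)
    (hc : ∀ j, 0 < c j) (hε : ∀ j, 0 < ε j) (hx : 0 ≤ x) (hy : y ∈ K)
    (hproj : ∀ z ∈ K,
      0 ≤ ∑ j, c j * ((Real.log (y j + ε j) - Real.log (x j + ε j)) * (z j - y j)))
    (hz : z ∈ K) :
    c ⬝ᵥ y ≤ c ⬝ᵥ x +
      ∑ j, c j * (z j + ε j) * (Real.log (y j + ε j) - Real.log (x j + ε j)) := by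
  have hterm : c ⬝ᵥ y ≤ c ⬝ᵥ x +
      ∑ j, c j * ((y j + ε j) * (Real.log (y j + ε j) - Real.log (x j + ε j))) := by
    simp only [dotProduct, ← Finset.sum_add_distrib, ← mul_add]
    refine Finset.sum_le_sum fun j _ => mul_le_mul_of_nonneg_left ?_ (hc j).le
    have ha : 0 < y j + ε j := add_pos_of_nonneg_of_pos (hK.nonneg y hy j) (hε j)
    have hb : 0 < x j + ε j := add_pos_of_nonneg_of_pos (hx j) (hε j)
    have hlog := Real.one_sub_inv_le_log_of_pos (div_pos ha hb)
    rw [Real.log_div ha.ne' hb.ne', inv_div] at hlog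
    have hmul := mul_le_mul_of_nonneg_left hlog ha.le
    rw [mul_sub, mul_div_cancel₀ _ ha.ne'] at hmul
    linarith
  have h := add_le_add hterm (hproj z hz)
  rw [add_zero, add_assoc, ← Finset.sum_add_distrib] at h
  refine h.trans_eq ?_
  congr 1
  exact Finset.sum_congr rfl fun j _ => by ring

theorem le_of_le_three_mul_log {n p : ℝ} (hn : 1 ≤ n) (hp : 0 ≤ p)
    (h : p ≤ 3 * Real.log (1 + n * p)) : p ≤ 20 * Real.log (2 * n) := by
  have h1 : Real.log (1 + n * p) ≤ Real.log (2 * n) + Real.log ((1 + p) / 6) + 2 := by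
    have h6 : Real.log 3 ≤ 2 := by
      have := Real.log_le_sub_one_of_pos (show (0 : ℝ) < 3 by norm_num)
      linarith
    have : 1 + n * p ≤ 2 * n * ((1 + p) / 6) * 3 := by nlinarith
    have := Real.log_le_log (by positivity) this
    rw [Real.log_mul (by positivity) (by norm_num), Real.log_mul (by positivity) (by positivity)]
      at this
    linarith
  have h2 := Real.log_le_sub_one_of_pos (show 0 < (1 + p) / 6 by positivity)
  have h3 : Real.log 2 ≤ Real.log (2 * n) := Real.log_le_log (by norm_num) (by linarith)
  have := Real.log_two_gt_d9
  linarith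

theorem cost_le_log_card_mul [Nonempty ι] (hc : ∀ j, 0 < c j) (hx : 0 ≤ x) (hz : 0 ≤ z)
    {V : ℝ} (hV : 0 < V) (hzV : c ⬝ᵥ z ≤ 2 * V) (hε : ∀ j, ε j = V / (Fintype.card ι * c j))
    (h : c ⬝ᵥ x ≤ ∑ j, c j * (z j + ε j) * (Real.log (x j + ε j) - Real.log (ε j))) :
    c ⬝ᵥ x ≤ 20 * Real.log (2 * Fintype.card ι) * V := by
  have hn : (1 : ℝ) ≤ Fintype.card ι := by exact_mod_cast Fintype.card_pos
  set n : ℝ := (Fintype.card ι : ℝ) with hn_def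
  have hn0 : 0 < n := by linarith
  have hεpos : ∀ j, 0 < ε j := fun j => by
    have := hc j
    rw [hε]; positivity
  have hcx : 0 ≤ c ⬝ᵥ x := Finset.sum_nonneg fun j _ => mul_nonneg (hc j).le (hx j)
  have hΛ : ∀ j, Real.log (x j + ε j) - Real.log (ε j) ≤ Real.log (1 + n * (c ⬝ᵥ x / V)) := by
    intro j
    have hcj := hc j
    have hxj : 0 ≤ x j := hx j
    rw [← Real.log_div (by linarith [hεpos j]) (hεpos j).ne']
    refine Real.log_le_log (div_pos (by linarith [hεpos j]) (hεpos j)) ?_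
    rw [add_div, div_self (hεpos j).ne', add_comm, hε j]
    gcongr 1 + ?_
    have : x j / (V / (n * c j)) = n * ((c j * x j) / V) := by field_simp
    rw [this]
    gcongr
    exact Finset.single_le_sum (f := fun j => c j * x j)
      (fun i _ => mul_nonneg (hc i).le (hx i)) (Finset.mem_univ j)
  have hsum : ∑ j, c j * (z j + ε j) = c ⬝ᵥ z + V := by
    have : ∀ j, c j * ε j = V / n := fun j => by
      have := (hc j).ne'
      rw [hε]; field_simp
    simp only [mul_add, Finset.sum_add_distrib, this, dotProduct, Finset.sum_const,
      Finset.card_univ, nsmul_eq_mul, ← hn_def]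
    rw [mul_div_cancel₀ _ hn0.ne']
  have hΛ0 : 0 ≤ Real.log (1 + n * (c ⬝ᵥ x / V)) :=
    Real.log_nonneg (by have : 0 ≤ n * (c ⬝ᵥ x / V) := by positivity
                        linarith)
  have hle : c ⬝ᵥ x ≤ 3 * V * Real.log (1 + n * (c ⬝ᵥ x / V)) := calc
    c ⬝ᵥ x ≤ ∑ j, c j * (z j + ε j) * Real.log (1 + n * (c ⬝ᵥ x / V)) :=
      h.trans (Finset.sum_le_sum fun j _ => mul_le_mul_of_nonneg_left (hΛ j)
        (mul_nonneg (hc j).le (add_nonneg (hz j) (hεpos j).le)))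
    _ = (c ⬝ᵥ z + V) * Real.log (1 + n * (c ⬝ᵥ x / V)) := by rw [← Finset.sum_mul, hsum]
    _ ≤ _ := mul_le_mul_of_nonneg_right (by linarith) hΛ0
  have := le_of_le_three_mul_log hn (p := c ⬝ᵥ x / V) (by positivity) (by
    rw [div_le_iff₀ hV]; linarith)
  rwa [div_le_iff₀ hV] at this

end Projection

section Algorithm

variable {ι : Type*}

/-- State of the guess-and-double algorithm: the guessed optimum, the solution accumulated in the
finished phases, and the solution of the running phase. -/
structure CoverState (ι : Type*) where
  guess : ℝ
  past : ι → ℝ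
  current : ι → ℝ

/-- The solution held in a state. -/
def CoverState.total (s : CoverState ι) : ι → ℝ := s.past + s.current

variable [Fintype ι] {K L : Set (ι → ℝ)} {c x' : ι → ℝ}

/-- The invariant of the guess-and-double algorithm, relative to the last request `K`. -/
structure CoverState.Invariant (c : ι → ℝ) (K : Set (ι → ℝ)) (s : CoverState ι) : Prop where
  guess_nonneg : 0 ≤ s.guess
  guess_le : ∀ z ∈ K, s.guess ≤ c ⬝ᵥ z
  past_nonneg : 0 ≤ s.past
  current_nonneg : 0 ≤ s.current
  cost_past : c ⬝ᵥ s.past ≤ 20 * Real.log (2 * Fintype.card ι) * s.guess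
  cost_current : c ⬝ᵥ s.current ≤ 20 * Real.log (2 * Fintype.card ι) * s.guess
  cost_entropy : 0 < s.guess → ∀ z ∈ K, c ⬝ᵥ s.current ≤
    ∑ j, c j * (z j + s.guess / (Fintype.card ι * c j)) *
      (Real.log (s.current j + s.guess / (Fintype.card ι * c j)) -
        Real.log (s.guess / (Fintype.card ι * c j)))

theorem CoverState.Invariant.mono {s : CoverState ι} (h : s.Invariant c K) (hL : L ⊆ K) :
    s.Invariant c L :=
  { h with
    guess_le := fun z hz => h.guess_le z (hL hz)
    cost_entropy := fun h0 z hz => h.cost_entropy h0 z (hL hz) }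

theorem CoverState.Invariant.total_nonneg {s : CoverState ι} (h : s.Invariant c K) :
    0 ≤ s.total :=
  add_nonneg h.past_nonneg h.current_nonneg

theorem CoverState.Invariant.cost_total_le [Nonempty ι] {s : CoverState ι} (h : s.Invariant c K)
    {z : ι → ℝ} (hz : z ∈ K) :
    c ⬝ᵥ s.total ≤ 40 * Real.log (2 * Fintype.card ι) * c ⬝ᵥ z := by
  have hn : (1 : ℝ) ≤ Fintype.card ι := by exact_mod_cast Fintype.card_pos
  have hlog : 0 ≤ Real.log (2 * Fintype.card ι) := Real.log_nonneg (by linarith)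
  have hmul := mul_le_mul_of_nonneg_left (h.guess_le z hz) hlog
  rw [CoverState.total, dotProduct_add]
  linarith [h.cost_past, h.cost_current]

/-- One entropic projection preserves the invariant if the guess is at least half the optimum. -/
theorem CoverState.Invariant.exists_project [Nonempty ι] (hK : IsCoveringSet K)
    (hc : ∀ j, 0 < c j) {s : CoverState ι} (h : s.Invariant c K) (hV : 0 < s.guess)
    {z₀ : ι → ℝ} (hz₀ : z₀ ∈ K) (hz₀V : c ⬝ᵥ z₀ ≤ 2 * s.guess) :
    ∃ y ∈ K, s.current ≤ y ∧ CoverState.Invariant c K ⟨s.guess, s.past, y⟩ := by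
  have hn : (0 : ℝ) < Fintype.card ι := by exact_mod_cast Fintype.card_pos
  have hε : ∀ j, 0 < s.guess / (Fintype.card ι * c j) := fun j => by
    have := hc j
    positivity
  obtain ⟨y, hy, hproj⟩ :=
    hK.exists_entropic_projection ⟨z₀, hz₀⟩ hc hε h.current_nonneg
  have hent : ∀ z ∈ K, c ⬝ᵥ y ≤ ∑ j, c j * (z j + s.guess / (Fintype.card ι * c j)) *
      (Real.log (y j + s.guess / (Fintype.card ι * c j)) -
        Real.log (s.guess / (Fintype.card ι * c j))) := by
    intro z hz
    have h1 := hK.cost_entropic_projection hc hε h.current_nonneg hy hproj hz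
    have h2 := h1.trans (add_le_add_left (h.cost_entropy hV z hz) _)
    rw [← Finset.sum_add_distrib] at h2
    exact h2.trans_eq (Finset.sum_congr rfl fun j _ => by ring)
  exact ⟨y, hy, hK.le_entropic_projection hc hε hy hproj,
    { h with
      current_nonneg := hK.nonneg y hy
      cost_current := cost_le_log_card_mul hc (hK.nonneg y hy) (hK.nonneg z₀ hz₀) hV hz₀V
        (fun _ => rfl) (hent z₀ hz₀)
      cost_entropy := fun _ => hent }⟩

theorem CoverState.Invariant.exists_step [Nonempty ι] (hK : IsCoveringSet K) (hne : K.Nonempty)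
    (hc : ∀ j, 0 < c j) {s : CoverState ι} (h : s.Invariant c K) :
    ∃ t : CoverState ι, t.Invariant c K ∧ t.total ∈ K ∧ s.total ≤ t.total := by
  by_cases hs : s.total ∈ K
  · exact ⟨s, h, hs, le_rfl⟩
  have hpos : ∀ z ∈ K, 0 < c ⬝ᵥ z := by
    intro z hz
    have hz0 := hK.nonneg z hz
    refine (Finset.sum_nonneg fun j _ => mul_nonneg (hc j).le (hz0 j)).lt_of_ne fun h0 => hs ?_
    have hall := (Finset.sum_eq_zero_iff_of_nonneg
      fun j _ => mul_nonneg (hc j).le (hz0 j)).1 h0.symm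
    refine hK.upward z hz _ fun j => ?_
    have := (mul_eq_zero.1 (hall j (Finset.mem_univ j))).resolve_left (hc j).ne'
    rw [this]
    exact h.total_nonneg j
  by_cases hz : ∃ z ∈ K, c ⬝ᵥ z ≤ 2 * s.guess
  · obtain ⟨z, hz, hzV⟩ := hz
    obtain ⟨y, hy, hle, hinv⟩ :=
      h.exists_project hK hc (by linarith [hpos z hz]) hz hzV
    exact ⟨_, hinv, hK.upward y hy _ (le_add_of_nonneg_left h.past_nonneg),
      add_le_add_right hle _⟩
  · push Not at hz
    obtain ⟨z, hzK, hmin⟩ := hK.exists_forall_le hne hc (f := fun z => c ⬝ᵥ z) (b := 0)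
      (by unfold dotProduct; fun_prop) (fun y _ => by simp)
    have hn : (1 : ℝ) ≤ Fintype.card ι := by exact_mod_cast Fintype.card_pos
    have hlog : 0 ≤ Real.log (2 * Fintype.card ι) := Real.log_nonneg (by linarith)
    have hrestart : CoverState.Invariant c K ⟨c ⬝ᵥ z, s.past + s.current, 0⟩ :=
      { guess_nonneg := (hpos z hzK).le
        guess_le := hmin
        past_nonneg := add_nonneg h.past_nonneg h.current_nonneg
        current_nonneg := le_rfl
        cost_past := by
          have hmul := mul_le_mul_of_nonneg_left (hz z hzK).le hlog
          rw [dotProduct_add]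
          linarith [h.cost_past, h.cost_current]
        cost_current := by
          have := hpos z hzK
          simp only [dotProduct_zero]
          positivity
        cost_entropy := fun _ w _ => by simp }
    obtain ⟨y, hy, hle, hinv⟩ := hrestart.exists_project hK hc (hpos z hzK) hzK
      (by linarith [hpos z hzK])
    exact ⟨_, hinv, hK.upward y hy _ (le_add_of_nonneg_left hrestart.past_nonneg),
      le_add_of_nonneg_right hle⟩

/-- A state of the covering algorithm together with the solution output by the
learning-augmented algorithm. -/
structure AdviceState (ι : Type*) where
  cover : CoverState ι
  output : ι → ℝ

/-- The invariant of the learning-augmented algorithm with advice `x'`, relative to the last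
request `K`. -/
structure AdviceState.Invariant (c x' : ι → ℝ) (K : Set (ι → ℝ)) (s : AdviceState ι) : Prop where
  cover : s.cover.Invariant c K
  robust : s.output ≤ s.cover.total ∨
    (c ⬝ᵥ x' ≤ c ⬝ᵥ s.cover.total ∧ s.output ≤ s.cover.total + x')
  consistent : x' ∈ K → ∃ u, 0 ≤ u ∧ c ⬝ᵥ u ≤ c ⬝ᵥ x' ∧ u ≤ s.cover.total ∧ s.output ≤ u + x'

theorem AdviceState.Invariant.mono {s : AdviceState ι} (h : s.Invariant c x' K) (hL : L ⊆ K) :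
    s.Invariant c x' L :=
  ⟨h.cover.mono hL, h.robust, fun hx => h.consistent (hL hx)⟩

theorem AdviceState.Invariant.exists_step [Nonempty ι] (hK : IsCoveringSet K) (hne : K.Nonempty)
    (hc : ∀ j, 0 < c j) (hx' : 0 ≤ x') {s : AdviceState ι} (h : s.Invariant c x' K) :
    ∃ t : AdviceState ι, s.output ≤ t.output ∧ t.Invariant c x' K ∧ t.output ∈ K := by
  obtain ⟨t, ht, htK, hst⟩ := h.cover.exists_step hK hne hc
  have hcost : c ⬝ᵥ s.cover.total ≤ c ⬝ᵥ t.total :=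
    dotProduct_le_dotProduct_of_nonneg_left hst fun j => (hc j).le
  by_cases hfollow : x' ∈ K ∧ c ⬝ᵥ x' < c ⬝ᵥ t.total
  · refine ⟨⟨t, s.output ⊔ x'⟩, le_sup_left, ⟨ht, Or.inr ⟨hfollow.2.le, ?_⟩, fun hx => ?_⟩,
      hK.upward x' hfollow.1 _ le_sup_right⟩
    · refine sup_le ?_ (le_add_of_nonneg_left ht.total_nonneg)
      rcases h.robust with h1 | h1
      · exact h1.trans (hst.trans (le_add_of_nonneg_right hx'))
      · exact h1.2.trans (add_le_add_left hst _)
    · obtain ⟨u, hu0, hu, hus, huw⟩ := h.consistent hx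
      exact ⟨u, hu0, hu, hus.trans hst, sup_le huw (le_add_of_nonneg_left hu0)⟩
  · refine ⟨⟨t, s.output ⊔ t.total⟩, le_sup_left, ⟨ht, ?_, fun hx => ?_⟩,
      hK.upward _ htK _ le_sup_right⟩
    · rcases h.robust with h1 | h1
      · exact Or.inl (sup_le (h1.trans hst) le_rfl)
      · exact Or.inr ⟨h1.1.trans hcost, sup_le (h1.2.trans (add_le_add_left hst _))
          (le_add_of_nonneg_right hx')⟩
    · obtain ⟨u, -, hu, hus, huw⟩ := h.consistent hx
      refine ⟨t.total, ht.total_nonneg, ?_, le_rfl, sup_le (huw.trans (add_le_add_left (hus.trans hst) _))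
        (le_add_of_nonneg_right hx')⟩
      by_contra! hlt
      exact hfollow ⟨hx, hlt⟩

theorem AdviceState.Invariant.cost_output_le {s : AdviceState ι} (h : s.Invariant c x' K)
    (hc : ∀ j, 0 < c j) : c ⬝ᵥ s.output ≤ 2 * c ⬝ᵥ s.cover.total := by
  have hc0 : 0 ≤ c := fun j => (hc j).le
  rcases h.robust with h1 | ⟨h1, h2⟩
  · have := dotProduct_le_dotProduct_of_nonneg_left h1 hc0
    have : 0 ≤ c ⬝ᵥ s.cover.total :=
      Finset.sum_nonneg fun j _ => mul_nonneg (hc0 j) (h.cover.total_nonneg j)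
    linarith
  · have := dotProduct_le_dotProduct_of_nonneg_left h2 hc0
    rw [dotProduct_add] at this
    linarith

theorem AdviceState.Invariant.cost_output_le_advice {s : AdviceState ι}
    (h : s.Invariant c x' K) (hc : ∀ j, 0 < c j) (hx' : x' ∈ K) :
    c ⬝ᵥ s.output ≤ 2 * c ⬝ᵥ x' := by
  obtain ⟨u, -, hu, -, huw⟩ := h.consistent hx'
  have := dotProduct_le_dotProduct_of_nonneg_left huw fun j => (hc j).le
  rw [dotProduct_add] at this
  linarith

/-- The state before the first request. -/
def AdviceState.start : AdviceState ι := ⟨⟨0, 0, 0⟩, 0⟩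

theorem AdviceState.invariant_start (hK : IsCoveringSet K) (hc : ∀ j, 0 < c j) (hx' : 0 ≤ x') :
    AdviceState.start.Invariant c x' K where
  cover :=
    { guess_nonneg := le_rfl
      guess_le := fun z hz =>
        Finset.sum_nonneg fun j _ => mul_nonneg (hc j).le (hK.nonneg z hz j)
      past_nonneg := le_rfl
      current_nonneg := le_rfl
      cost_past := by simp [AdviceState.start]
      cost_current := by simp [AdviceState.start]
      cost_entropy := fun h => absurd h (lt_irrefl 0) }
  robust := Or.inl (by simp [AdviceState.start, CoverState.total])
  consistent := fun _ => ⟨0, le_rfl,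
    by rw [dotProduct_zero]; exact Finset.sum_nonneg fun j _ => mul_nonneg (hc j).le (hx' j),
    by simp [AdviceState.start, CoverState.total], by simpa [AdviceState.start] using hx'⟩

theorem AdviceState.exists_step [Nonempty ι] (hc : ∀ j, 0 < c j) (hx' : 0 ≤ x')
    (s : AdviceState ι) (K : Set (ι → ℝ)) :
    ∃ t : AdviceState ι, s.output ≤ t.output ∧
      (IsCoveringSet K → K.Nonempty → s.Invariant c x' K → t.Invariant c x' K ∧ t.output ∈ K) := by
  by_cases h : IsCoveringSet K ∧ K.Nonempty ∧ s.Invariant c x' K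
  · obtain ⟨t, hst, ht⟩ := h.2.2.exists_step h.1 h.2.1 hc hx'
    exact ⟨t, hst, fun _ _ _ => ht⟩
  · exact ⟨s, le_rfl, fun h1 h2 h3 => absurd ⟨h1, h2, h3⟩ h⟩

end Algorithm

/-- The left fold of an update function along a finite sequence. -/
def finFold {σ α : Type*} (step : σ → α → σ) (s₀ : σ) : (i : ℕ) → (Fin i → α) → σ
  | 0, _ => s₀
  | i + 1, a => step (finFold step s₀ i fun k => a k.castSucc) (a (Fin.last i))

/-- The nonnegative vectors feasible for the covering constraint `∑ j, z j • A j ⪰ B`. -/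
def sdpFeasible {ι κ : Type*} [Fintype ι] (A : ι → Matrix κ κ ℝ) (B : Matrix κ κ ℝ) :
    Set (ι → ℝ) :=
  {z | (∀ j, 0 ≤ z j) ∧ (∑ j, z j • A j - B).PosSemidef}

section Semidefinite

variable {ι κ : Type*} [Fintype ι] {A : ι → Matrix κ κ ℝ} {B B' : Matrix κ κ ℝ}

theorem isClosed_posSemidef [Fintype κ] : IsClosed {M : Matrix κ κ ℝ | M.PosSemidef} := by
  simp only [posSemidef_iff_dotProduct_mulVec, Set.ofPred_and, Set.ofPred_forall, IsHermitian]
  refine (isClosed_eq (by fun_prop) continuous_id).inter (isClosed_iInter fun v => ?_)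
  exact isClosed_le continuous_const
    (continuous_const.dotProduct (continuous_id.matrix_mulVec continuous_const))

theorem isCoveringSet_sdpFeasible [Fintype κ] (hA : ∀ j, (A j).PosSemidef) :
    IsCoveringSet (sdpFeasible A B) where
  nonneg := fun _ hz => hz.1
  closed := by
    have hcont : Continuous fun z : ι → ℝ => ∑ j, z j • A j - B := by fun_prop
    exact (isClosed_Ici (a := (0 : ι → ℝ))).inter (isClosed_posSemidef.preimage hcont)
  convex := by
    rintro x ⟨hx0, hx⟩ y ⟨hy0, hy⟩ a b ha hb hab
    refine ⟨fun j => add_nonneg (mul_nonneg ha (hx0 j)) (mul_nonneg hb (hy0 j)), ?_⟩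
    have heq : ∑ j, (a • x + b • y) j • A j - B =
        a • (∑ j, x j • A j - B) + b • (∑ j, y j • A j - B) := by
      simp only [Pi.add_apply, Pi.smul_apply, smul_eq_mul, add_smul, mul_smul,
        Finset.sum_add_distrib, smul_sub, Finset.smul_sum]
      rw [sub_add_sub_comm, ← add_smul, hab, one_smul]
    rw [heq]
    exact (hx.smul ha).add (hy.smul hb)
  upward := by
    rintro x ⟨hx0, hx⟩ y hxy
    refine ⟨fun j => (hx0 j).trans (hxy j), ?_⟩
    have heq : ∑ j, y j • A j - B = (∑ j, x j • A j - B) + ∑ j, (y j - x j) • A j := by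
      simp only [sub_smul, Finset.sum_sub_distrib]
      abel
    rw [heq]
    exact hx.add (posSemidef_sum _ fun j _ => (hA j).smul (sub_nonneg.2 (hxy j)))

theorem sdpFeasible_anti (h : (B' - B).PosSemidef) : sdpFeasible A B' ⊆ sdpFeasible A B := by
  rintro z ⟨hz0, hz⟩
  exact ⟨hz0, by simpa using hz.add h⟩

end Semidefinite

/-- Learning-augmented online covering SDP (Theorem 1.2 / Theorem 3.1): there is an
online algorithm `F` (mapping each prefix of arriving PSD matrices to a nonnegative
solution) that is monotone, feasible, `O(log(κn/λ))`-robust and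
`O(1/(1−λ))`-consistent, where `κ` bounds the ratio between any two positive
eigenvalues among the matrices `A_1,…,A_n, B^{(1)},…,B^{(m)}`. -/
theorem stmt2 :
    ∃ C1 C2 C3 : ℝ, 0 < C1 ∧ 0 < C2 ∧ 0 < C3 ∧
      ∀ (n d : ℕ), 1 ≤ n → 1 ≤ d →
      ∀ (A : Fin n → Matrix (Fin d) (Fin d) ℝ), (∀ j, (A j).PosSemidef) →
      ∀ (c x' : Fin n → ℝ), (∀ j, 0 < c j) → (∀ j, 0 ≤ x' j) →
      ∀ (lam : ℝ), 0 < lam → lam < 1 →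
      ∀ (κ : ℝ), 1 ≤ κ →
      ∃ F : (i : ℕ) → (Fin i → Matrix (Fin d) (Fin d) ℝ) → (Fin n → ℝ),
        -- F always outputs a vector in ℝ_{≥0}^n on sequences of PSD matrices
        (∀ (i : ℕ) (Bs : Fin i → Matrix (Fin d) (Fin d) ℝ),
          (∀ k, (Bs k).PosSemidef) → ∀ j, 0 ≤ F i Bs j) ∧
        ∀ (m : ℕ), 1 ≤ m → ∀ (B : ℕ → Matrix (Fin d) (Fin d) ℝ),
          (∀ i, i < m → (B i).PosSemidef) →
          (∀ i, i + 1 < m → (B (i + 1) - B i).PosSemidef) →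
          -- (i) bounded ratio between positive eigenvalues
          (∀ (M N : Matrix (Fin d) (Fin d) ℝ),
            ((∃ j, M = A j) ∨ (∃ i, i < m ∧ M = B i)) →
            ((∃ j, N = A j) ∨ (∃ i, i < m ∧ N = B i)) →
            ∀ μ ν : ℝ, 0 < μ → 0 < ν →
              (∃ v : Fin d → ℝ, v ≠ 0 ∧ M.mulVec v = μ • v) →
              (∃ w : Fin d → ℝ, w ≠ 0 ∧ N.mulVec w = ν • w) →
              μ ≤ κ * ν) →
          -- (ii) existence of a feasible nonnegative solution
          (∃ z : Fin n → ℝ, (∀ j, 0 ≤ z j) ∧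
            (∑ j, z j • A j - B (m - 1)).PosSemidef) →
          -- (a) monotonicity
          ((∀ i, i < m → ∀ j,
              F i (fun k : Fin i => B k.1) j ≤ F (i + 1) (fun k : Fin (i + 1) => B k.1) j) ∧
          -- (b) feasibility
          (∀ i, 1 ≤ i → i ≤ m →
              (∑ j, F i (fun k : Fin i => B k.1) j • A j - B (i - 1)).PosSemidef) ∧
          -- (c) robustness and consistency against any feasible z
          (∀ z : Fin n → ℝ, (∀ j, 0 ≤ z j) →
            (∑ j, z j • A j - B (m - 1)).PosSemidef →
            (∑ j, c j * F m (fun k : Fin m => B k.1) j ≤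
              C1 * Real.log (2 * κ * (n : ℝ) / lam) * ∑ j, c j * z j) ∧
            (∑ j, c j * F m (fun k : Fin m => B k.1) j ≤
              C2 / (1 - lam) * ∑ j, c j * x' j +
                C3 * Real.log (2 * κ * (n : ℝ)) * ∑ j, c j * z j)) ∧
          -- (d) consistency when the advice is feasible
          ((∑ j, x' j • A j - B (m - 1)).PosSemidef →
            ∑ j, c j * F m (fun k : Fin m => B k.1) j ≤
              C2 / (1 - lam) * ∑ j, c j * x' j)) := by
  refine ⟨80, 2, 80, by norm_num, by norm_num, by norm_num, ?_⟩
  intro n d hn _ A hA c x' hc hx' lam hlam0 hlam1 κ hκ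
  have : Nonempty (Fin n) := ⟨⟨0, hn⟩⟩
  choose step hstep_le hstep using AdviceState.exists_step (c := c) hc hx'
  let run : (i : ℕ) → (Fin i → Matrix (Fin d) (Fin d) ℝ) → AdviceState (Fin n) :=
    finFold (fun s B => step s (sdpFeasible A B)) AdviceState.start
  refine ⟨fun i Bs => (run i Bs).output, ?_, ?_⟩
  · intro i
    induction i with
    | zero => exact fun _ _ _ => le_rfl
    | succ i ih =>
      exact fun Bs hBs j => (ih _ (fun k => hBs k.castSucc) j).trans (hstep_le _ _ j)
  intro m hm B _ hmono _ hfeas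
  have hanti : ∀ k i, i + k < m → sdpFeasible A (B (i + k)) ⊆ sdpFeasible A (B i) := by
    intro k i
    induction k with
    | zero => exact fun _ => subset_rfl
    | succ k ih =>
      exact fun h => (sdpFeasible_anti (hmono (i + k) h)).trans (ih (Nat.lt_of_succ_lt h))
  have hne : ∀ i, i < m → (sdpFeasible A (B i)).Nonempty := by
    intro i hi
    obtain ⟨z, hz⟩ := hfeas
    have h := hanti (m - 1 - i) i (by omega)
    rw [show i + (m - 1 - i) = m - 1 by omega] at h
    exact ⟨z, h hz⟩
  have hinv : ∀ i, i < m →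
      (run (i + 1) fun k => B k.1).Invariant c x' (sdpFeasible A (B i)) ∧
        (run (i + 1) fun k => B k.1).output ∈ sdpFeasible A (B i) := by
    intro i hi
    have hK : IsCoveringSet (sdpFeasible A (B i)) := isCoveringSet_sdpFeasible hA
    refine hstep _ _ hK (hne i hi) ?_
    clear hK
    induction i with
    | zero => exact AdviceState.invariant_start (isCoveringSet_sdpFeasible hA) hc hx'
    | succ i ih =>
      have hi' : i < m := Nat.lt_of_succ_lt hi
      exact (hstep _ _ (isCoveringSet_sdpFeasible hA) (hne i hi') (ih hi')).1.mono (hanti 1 i hi)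
  obtain ⟨l, rfl⟩ := Nat.exists_eq_add_of_le' hm
  have hlast := (hinv l (Nat.lt_succ_self l)).1
  have hn1 : (1 : ℝ) ≤ n := by exact_mod_cast hn
  have hlog1 : Real.log (2 * n) ≤ Real.log (2 * κ * n) :=
    Real.log_le_log (by positivity) (by nlinarith)
  have hlog2 : Real.log (2 * κ * n) ≤ Real.log (2 * κ * n / lam) := by
    have hpos : 0 < 2 * κ * n := by positivity
    exact Real.log_le_log hpos (le_div_self hpos.le hlam0 hlam1.le)
  have hx'cost : 0 ≤ c ⬝ᵥ x' := Finset.sum_nonneg fun j _ => mul_nonneg (hc j).le (hx' j)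
  have hratio : 2 ≤ 2 / (1 - lam) := le_div_self (by norm_num) (by linarith) (by linarith)
  refine ⟨fun i _ => hstep_le _ _, ?_, ?_, ?_⟩
  · intro i hi him
    obtain ⟨k, rfl⟩ := Nat.exists_eq_add_of_le' hi
    exact (hinv k him).2.2
  · intro z hz0 hz
    have hcz : 0 ≤ c ⬝ᵥ z := Finset.sum_nonneg fun j _ => mul_nonneg (hc j).le (hz0 j)
    have hcost := hlast.cover.cost_total_le (z := z) ⟨hz0, hz⟩
    have hout := hlast.cost_output_le hc
    rw [Fintype.card_fin] at hcost
    have h1 := mul_le_mul_of_nonneg_right hlog1 hcz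
    have h2 := mul_le_mul_of_nonneg_right hlog2 hcz
    have h3 : 0 ≤ 2 / (1 - lam) * c ⬝ᵥ x' := mul_nonneg (by linarith) hx'cost
    refine ⟨?_, ?_⟩
    · change c ⬝ᵥ _ ≤ 80 * Real.log (2 * κ * n / lam) * c ⬝ᵥ z
      linarith
    · change c ⬝ᵥ _ ≤ 2 / (1 - lam) * c ⬝ᵥ x' + 80 * Real.log (2 * κ * n) * c ⬝ᵥ z
      linarith
  · intro hx
    exact (hlast.cost_output_le_advice hc ⟨hx', hx⟩).trans
      (mul_le_mul_of_nonneg_right hratio hx'cost)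
end
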